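/- Let Q be a rack, A a commutative ring, m ⊆ A an ideal, and suppose Inn(Q) is finite and its order |Inn(Q)|, regarded as an element of A, is a unit. Then every 2-cocycle is cohomologous to exactly one entropic 2-cochain: for every A-linear map f: AQ² → AQ² with all matrix entries in m and d f = 0, there exists exactly one entropic A-linear map e: AQ² → AQ² with entries in m such that f − e = d g for some A-linear g: AQ → AQ with entries in m; moreover every such entropic e satisfies d e = 0. -/

import Mathlib

open TensorProduct

noncomputable section

/-- A rack: a set with a binary operation `act x y = x ^ y` such that all right
translations are bijective and the operation is right self-distributive. -/
structure YBRack (Q : Type*) where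
  act : Q → Q → Q
  act_bijective : ∀ y : Q, Function.Bijective fun x => act x y
  self_distrib : ∀ x y z : Q, act (act x y) z = act (act x z) (act y z)

namespace YBRack

variable {Q : Type*} {A : Type*} [CommRing A]

/-- Right translation by `y` as a permutation of `Q`. -/
def rho (R : YBRack Q) (y : Q) : Equiv.Perm Q :=
  Equiv.ofBijective _ (R.act_bijective y)

/-- The inner automorphism group of a rack: the subgroup of `Perm Q` generated
by all right translations. -/
def Inn (R : YBRack Q) : Subgroup (Equiv.Perm Q) :=
  Subgroup.closure (Set.range R.rho)

/-- Behavioural equivalence: `x ≡ y` iff `ϱ(x) = ϱ(y)`. -/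
def BEquiv (R : YBRack Q) (x y : Q) : Prop := R.rho x = R.rho y

end YBRack
namespace YBRack

variable {Q : Type*} {A : Type*} [CommRing A]

open scoped Classical in
/-- The explicit coboundary of a 2-cochain (matrix on `Q × Q`). -/
def dTwo (R : YBRack Q) (f : Q × Q → Q × Q → A) (p q : Q × Q × Q) : A :=
  f (p.2.1, p.2.2) (q.2.1, q.2.2) *
      ((if R.act (R.act p.1 p.2.1) p.2.2 = R.act (R.act q.1 q.2.1) q.2.2 then 1 else 0)
        - (if p.1 = q.1 then 1 else 0))
  - f (p.1, p.2.2) (q.1, q.2.2) * (if R.act p.2.1 p.2.2 = R.act q.2.1 q.2.2 then 1 else 0)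
  + f (R.act p.1 p.2.1, p.2.2) (R.act q.1 q.2.1, q.2.2) * (if p.2.1 = q.2.1 then 1 else 0)
  + (f (p.1, p.2.1) (q.1, q.2.1)
      - f (R.act p.1 p.2.2, R.act p.2.1 p.2.2) (R.act q.1 q.2.2, R.act q.2.1 q.2.2)) *
      (if p.2.2 = q.2.2 then 1 else 0)

open scoped Classical in
/-- The explicit coboundary of a 1-cochain (matrix on `Q`). -/
def dOne (R : YBRack Q) (g : Q → Q → A) (p q : Q × Q) : A :=
  g p.2 q.2 * ((if R.act p.1 p.2 = R.act q.1 q.2 then 1 else 0) - (if p.1 = q.1 then 1 else 0))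
  - (g p.1 q.1 - g (R.act p.1 p.2) (R.act q.1 q.2)) * (if p.2 = q.2 then 1 else 0)

/-- Entropic matrix on `Q × Q`: quasi-diagonal and fully equivariant. -/
def EntropicMat2 (R : YBRack Q) (f : Q × Q → Q × Q → A) : Prop :=
  (∀ u v x y : Q, (¬ R.BEquiv u x ∨ ¬ R.BEquiv v y) → f (u, v) (x, y) = 0) ∧
  (∀ (u v x y : Q) (α β : R.Inn),
    f ((α : Equiv.Perm Q) u, (β : Equiv.Perm Q) v) ((α : Equiv.Perm Q) x, (β : Equiv.Perm Q) y)
      = f (u, v) (x, y))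

end YBRack

namespace YBRack

variable {Q : Type*} {A : Type*} [CommRing A] (R : YBRack Q)

theorem act_left_inj (z : Q) {x y : Q} : R.act x z = R.act y z ↔ x = y :=
  (R.act_bijective z).injective.eq_iff

variable {R}

theorem BEquiv.act_eq {y z : Q} (h : R.BEquiv y z) (x : Q) : R.act x y = R.act x z :=
  congrArg (fun α : Equiv.Perm Q => α x) h

theorem exists_act_ne {y z : Q} (h : ¬ R.BEquiv y z) : ∃ x, R.act x y ≠ R.act x z := by
  by_contra! hc
  exact h (Equiv.ext hc)

variable (R) in
theorem rho_mem_inn (y : Q) : R.rho y ∈ R.Inn :=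
  Subgroup.subset_closure ⟨y, rfl⟩

theorem map_act {α : Equiv.Perm Q} (hα : α ∈ R.Inn) (x y : Q) :
    α (R.act x y) = R.act (α x) (α y) := by
  induction hα using Subgroup.closure_induction generalizing x y with
  | mem α h =>
    obtain ⟨z, rfl⟩ := h
    exact R.self_distrib x y z
  | one => rfl
  | mul α β _ _ iα iβ => simp only [Equiv.Perm.mul_apply, iα, iβ]
  | inv α _ iα =>
    apply α.injective
    simp only [iα, Equiv.Perm.coe_inv, Equiv.apply_symm_apply]

theorem bEquiv_map {α : Equiv.Perm Q} (hα : α ∈ R.Inn) {x y : Q} :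
    R.BEquiv (α x) (α y) ↔ R.BEquiv x y := by
  have key : ∀ z, R.rho (α z) = α * R.rho z * α⁻¹ := fun z => Equiv.ext fun u => by
    have := map_act hα (α⁻¹ u) z
    rw [Equiv.Perm.coe_inv, Equiv.apply_symm_apply] at this
    exact this.symm
  simp [BEquiv, key]

open scoped Classical in
/-- The Kronecker delta. -/
def delta (x y : Q) : A := if x = y then 1 else 0

@[simp]
theorem delta_self (x : Q) : (delta x x : A) = 1 := if_pos rfl

theorem delta_of_ne {x y : Q} (h : x ≠ y) : (delta x y : A) = 0 := if_neg h

theorem delta_congr {P : Type*} {x y : Q} {x' y' : P} (h : x = y ↔ x' = y') :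
    (delta x y : A) = delta x' y' := by
  by_cases hxy : x = y
  · rw [hxy, h.mp hxy, delta_self, delta_self]
  · rw [delta_of_ne hxy, delta_of_ne (mt h.mpr hxy)]

@[simp]
theorem delta_act_right (x y z : Q) : (delta (R.act x z) (R.act y z) : A) = delta x y :=
  delta_congr (R.act_left_inj z)

@[simp]
theorem delta_map (α : Equiv.Perm Q) (x y : Q) : (delta (α x) (α y) : A) = delta x y :=
  delta_congr α.injective.eq_iff

variable (R)

theorem dOne_apply (g : Q → Q → A) (u v x y : Q) :
    R.dOne g (u, v) (x, y) =
      g v y * (delta (R.act u v) (R.act x y) - delta u x)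
      - (g u x - g (R.act u v) (R.act x y)) * delta v y :=
  rfl

theorem dTwo_apply (f : Q × Q → Q × Q → A) (u v w x y z : Q) :
    R.dTwo f (u, v, w) (x, y, z) =
      f (v, w) (y, z) * (delta (R.act (R.act u v) w) (R.act (R.act x y) z)
          - delta u x)
      - f (u, w) (x, z) * delta (R.act v w) (R.act y z)
      + f (R.act u v, w) (R.act x y, z) * delta v y
      + (f (u, v) (x, y) - f (R.act u w, R.act v w) (R.act x z, R.act y z)) *
          delta w z :=
  rfl

variable {R}

/-- The coboundary of 1-cochains is compatible with the diagonal action of inner automorphisms. -/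
theorem dOne_map {α : Equiv.Perm Q} (hα : α ∈ R.Inn) (g : Q → Q → A) (p q : Q × Q) :
    R.dOne g (p.map α α) (q.map α α) = R.dOne (fun x u => g (α x) (α u)) p q := by
  obtain ⟨u, v⟩ := p
  obtain ⟨x, y⟩ := q
  simp only [Prod.map_apply, dOne_apply, ← map_act hα, delta_map]

/-- The coboundary of 2-cochains is compatible with the diagonal action of inner automorphisms. -/
theorem dTwo_map {α : Equiv.Perm Q} (hα : α ∈ R.Inn) (f : Q × Q → Q × Q → A)
    (p q : Q × Q × Q) :
    R.dTwo f (p.map α (Prod.map α α)) (q.map α (Prod.map α α)) =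
      R.dTwo (fun p q => f (p.map α α) (q.map α α)) p q := by
  obtain ⟨u, v, w⟩ := p
  obtain ⟨x, y, z⟩ := q
  simp only [Prod.map_apply, dTwo_apply, ← map_act hα, delta_map]

variable (A R) in
/-- The coboundary of 1-cochains as a linear map. -/
def dOneLinear : (Q → Q → A) →ₗ[A] (Q × Q → Q × Q → A) where
  toFun := R.dOne
  map_add' g h := by
    funext p q
    simp only [dOne, Pi.add_apply]
    ring
  map_smul' c g := by
    funext p q
    simp only [dOne, Pi.smul_apply, smul_eq_mul, RingHom.id_apply]
    ring

variable (A R) in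
/-- The coboundary of 2-cochains as a linear map. -/
def dTwoLinear : (Q × Q → Q × Q → A) →ₗ[A] (Q × Q × Q → Q × Q × Q → A) where
  toFun := R.dTwo
  map_add' g h := by
    funext p q
    simp only [dTwo, Pi.add_apply]
    ring
  map_smul' c g := by
    funext p q
    simp only [dTwo, Pi.smul_apply, smul_eq_mul, RingHom.id_apply]
    ring

/-- Inner automorphisms act trivially on the cohomology class of a 2-cocycle. -/
theorem exists_dOne_eq_map_sub {m : Ideal A} {f : Q × Q → Q × Q → A} (hfm : ∀ p q, f p q ∈ m)
    (hf : ∀ p q, R.dTwo f p q = 0) {α : Equiv.Perm Q} (hα : α ∈ R.Inn) :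
    ∃ g : Q → Q → A, (∀ x u, g x u ∈ m) ∧
      R.dOne g = fun p q => f (p.map α α) (q.map α α) - f p q := by
  induction hα using Subgroup.closure_induction with
  | mem α h =>
    obtain ⟨w, rfl⟩ := h
    refine ⟨fun u x => f (u, w) (x, w), fun _ _ => hfm _ _, ?_⟩
    funext ⟨u, v⟩ ⟨x, y⟩
    have h := hf (u, v, w) (x, y, w)
    simp only [dTwo_apply, delta_act_right, delta_self] at h
    change R.dOne _ _ _ = f (R.act u w, R.act v w) (R.act x w, R.act y w) - f (u, v) (x, y)
    simp only [dOne_apply]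
    linear_combination h
  | one =>
    refine ⟨0, fun _ _ => m.zero_mem, ?_⟩
    funext p q
    simp [dOne]
  | mul α β hα hβ iα iβ =>
    obtain ⟨g, hgm, hg⟩ := iα
    obtain ⟨h, hhm, hh⟩ := iβ
    refine ⟨(fun x u => g (β x) (β u)) + h, fun _ _ => m.add_mem (hgm _ _) (hhm _ _), ?_⟩
    refine ((dOneLinear A R).map_add _ _).trans ?_
    funext p q
    change R.dOne (fun x u => g (β x) (β u)) p q + R.dOne h p q = _
    rw [← dOne_map hβ, hg, hh]
    exact sub_add_sub_cancel _ _ _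
  | inv α hα iα =>
    obtain ⟨g, hgm, hg⟩ := iα
    refine ⟨-(fun x u => g (α⁻¹ x) (α⁻¹ u)), fun _ _ => m.neg_mem (hgm _ _), ?_⟩
    refine ((dOneLinear A R).map_neg _).trans ?_
    funext p q
    change -R.dOne (fun x u => g (α⁻¹ x) (α⁻¹ u)) p q = _
    rw [← dOne_map (R.Inn.inv_mem hα), hg]
    simp [Prod.map]

theorem dTwo_eq_zero_of_entropic {e : Q × Q → Q × Q → A} (he : R.EntropicMat2 e)
    (p q : Q × Q × Q) : R.dTwo e p q = 0 := by
  obtain ⟨u, v, w⟩ := p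
  obtain ⟨x, y, z⟩ := q
  obtain ⟨hdiag, hequi⟩ := he
  have hleft : ∀ a u x w z, e (R.act u a, w) (R.act x a, z) = e (u, w) (x, z) := fun a u x w z =>
    hequi u w x z ⟨_, R.rho_mem_inn a⟩ 1
  have hboth : ∀ a u x w z, e (R.act u a, R.act w a) (R.act x a, R.act z a) = e (u, w) (x, z) :=
    fun a u x w z => hequi u w x z ⟨_, R.rho_mem_inn a⟩ ⟨_, R.rho_mem_inn a⟩
  have h₁ : e (v, w) (y, z) * (delta (R.act (R.act u v) w) (R.act (R.act x y) z)
      - delta u x) = 0 := by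
    by_cases h : ¬ R.BEquiv v y ∨ ¬ R.BEquiv w z
    · rw [hdiag _ _ _ _ h, zero_mul]
    · push Not at h
      simp [h.1.act_eq, h.2.act_eq]
  have h₂ : e (u, w) (x, z) * delta (R.act v w) (R.act y z) =
      e (R.act u v, w) (R.act x y, z) * delta v y := by
    by_cases h : R.BEquiv w z
    · rw [h.act_eq v, delta_act_right]
      by_cases hvy : v = y
      · rw [hvy, hleft]
      · rw [delta_of_ne hvy, mul_zero, mul_zero]
    · rw [hdiag _ _ _ _ (Or.inr h), hdiag _ _ _ _ (Or.inr h), zero_mul, zero_mul]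
  have h₃ : (e (u, v) (x, y) - e (R.act u w, R.act v w) (R.act x z, R.act y z)) *
      delta w z = 0 := by
    by_cases hwz : w = z
    · rw [hwz, hboth, sub_self, zero_mul]
    · rw [delta_of_ne hwz, mul_zero]
  simp only [dTwo_apply]
  linear_combination h₁ - h₂ + h₃

/-- A 2-cochain is equivariant if it is invariant under the diagonal action of `Inn`. -/
def Equivariant (R : YBRack Q) (f : Q × Q → Q × Q → A) : Prop :=
  ∀ α ∈ R.Inn, ∀ p q : Q × Q, f (p.map α α) (q.map α α) = f p q

theorem dOne_apply_of_equivariant {g : Q → Q → A}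
    (hg : ∀ α ∈ R.Inn, ∀ x u, g (α x) (α u) = g x u) (u v x y : Q) :
    R.dOne g (u, v) (x, y) =
      g v y * (delta (R.act u v) (R.act x y) - delta u x) := by
  have h : ∀ a u x, g (R.act u a) (R.act x a) = g u x := fun a => hg _ (R.rho_mem_inn a)
  simp only [dOne_apply]
  by_cases hvy : v = y
  · subst hvy
    rw [h, sub_self, zero_mul, sub_zero]
  · rw [delta_of_ne hvy, mul_zero, sub_zero]

/-- An entropic coboundary of an equivariant 1-cochain vanishes. -/
theorem dOne_eq_zero_of_entropic {g : Q → Q → A}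
    (hg : ∀ α ∈ R.Inn, ∀ x u, g (α x) (α u) = g x u) (he : R.EntropicMat2 (R.dOne g)) :
    R.dOne g = 0 := by
  funext ⟨u, v⟩ ⟨x, y⟩
  by_cases h : R.BEquiv v y
  · rw [dOne_apply_of_equivariant hg, h.act_eq, delta_act_right, sub_self, mul_zero]
    rfl
  · exact he.1 _ _ _ _ (Or.inr h)

theorem EntropicMat2.equivariant {e : Q × Q → Q × Q → A} (he : R.EntropicMat2 e) :
    R.Equivariant e :=
  fun α hα p q => he.2 p.1 p.2 q.1 q.2 ⟨α, hα⟩ ⟨α, hα⟩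

theorem EntropicMat2.sub {e e' : Q × Q → Q × Q → A} (he : R.EntropicMat2 e)
    (he' : R.EntropicMat2 e') : R.EntropicMat2 (e - e') := by
  refine ⟨fun u v x y h => ?_, fun u v x y α β => ?_⟩
  · simp only [Pi.sub_apply, he.1 _ _ _ _ h, he'.1 _ _ _ _ h, sub_self]
  · simp only [Pi.sub_apply, he.2, he'.2]

theorem EntropicMat2.smul (c : A) {e : Q × Q → Q × Q → A} (he : R.EntropicMat2 e) :
    R.EntropicMat2 (c • e) := by
  refine ⟨fun u v x y h => ?_, fun u v x y α β => ?_⟩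
  · simp only [Pi.smul_apply, he.1 _ _ _ _ h, smul_zero]
  · simp only [Pi.smul_apply, he.2]

/-- Summation over the inner automorphism group yields invariant functions. -/
theorem sum_inn_mul_right [Fintype R.Inn] {M : Type*} [AddCommMonoid M]
    (F : Equiv.Perm Q → M) {β : Equiv.Perm Q} (hβ : β ∈ R.Inn) :
    ∑ α : R.Inn, F ((α : Equiv.Perm Q) * β) = ∑ α : R.Inn, F α :=
  Fintype.sum_equiv (Equiv.mulRight (⟨β, hβ⟩ : R.Inn)) _ _ fun _ => rfl

theorem eq_zero_of_entropic_of_eq_dOne [Fintype R.Inn] (hunit : IsUnit (Fintype.card R.Inn : A))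
    {e : Q × Q → Q × Q → A} (he : R.EntropicMat2 e) {g : Q → Q → A} (hg : e = R.dOne g) :
    e = 0 := by
  have hsum : R.dOne (∑ α : R.Inn, fun x u => g (α.1 x) (α.1 u)) =
      (Fintype.card R.Inn : A) • e := by
    refine (map_sum (dOneLinear A R) _ _).trans ?_
    funext p q
    change (∑ α : R.Inn, R.dOne (fun x u => g (α.1 x) (α.1 u))) p q = _
    simp only [Finset.sum_apply, ← dOne_map (Subtype.prop _), ← hg,
      he.equivariant _ (Subtype.prop _)]
    simp
  have hzero := dOne_eq_zero_of_entropic (R := R)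
    (g := ∑ α : R.Inn, fun x u => g (α.1 x) (α.1 u)) (fun β hβ x u => by
      simpa only [Finset.sum_apply, Equiv.Perm.mul_apply] using
        sum_inn_mul_right (fun α => g (α x) (α u)) hβ) (hsum ▸ he.smul _)
  exact hunit.smul_eq_zero.mp (hsum ▸ hzero)

/-- If `|Inn|` is invertible, every 2-cocycle is cohomologous to an equivariant 2-cocycle. -/
theorem exists_equivariant_cohomologous [Fintype R.Inn]
    (hunit : IsUnit (Fintype.card R.Inn : A)) {m : Ideal A} {f : Q × Q → Q × Q → A}
    (hfm : ∀ p q, f p q ∈ m) (hf : ∀ p q, R.dTwo f p q = 0) :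
    ∃ F : Q × Q → Q × Q → A, R.Equivariant F ∧ (∀ p q, F p q ∈ m) ∧
      (∀ p q, R.dTwo F p q = 0) ∧
      ∃ g : Q → Q → A, (∀ x u, g x u ∈ m) ∧ R.dOne g = F - f := by
  obtain ⟨c, hc⟩ := hunit.exists_left_inv
  choose g hgm hg using fun α : R.Inn => exists_dOne_eq_map_sub hfm hf α.2
  refine ⟨c • ∑ α : R.Inn, fun p q : Q × Q => f (p.map α.1 α.1) (q.map α.1 α.1),
    fun β hβ p q => ?_, fun p q => ?_, fun p q => ?_, c • ∑ α, g α, fun x u => ?_, ?_⟩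
  · have := sum_inn_mul_right (fun α => f (p.map α α) (q.map α α)) hβ
    simp only [Pi.smul_apply, Finset.sum_apply]
    rw [← this]
    rfl
  · simp only [Pi.smul_apply, Finset.sum_apply, smul_eq_mul]
    exact m.mul_mem_left _ (m.sum_mem fun _ _ => hfm _ _)
  · change dTwoLinear A R _ p q = 0
    rw [map_smul, map_sum]
    simp only [Pi.smul_apply, Finset.sum_apply]
    rw [Finset.sum_eq_zero, smul_zero]
    intro α _
    exact (dTwo_map α.2 f p q).symm.trans (hf _ _)
  · simp only [Pi.smul_apply, Finset.sum_apply, smul_eq_mul]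
    exact m.mul_mem_left _ (m.sum_mem fun _ _ => hgm _ _ _)
  · change dOneLinear A R _ = _
    rw [map_smul, map_sum]
    change c • ∑ α, R.dOne (g α) = _
    funext p q
    simp only [hg, Pi.smul_apply, Pi.sub_apply, Finset.sum_apply, smul_eq_mul,
      Finset.sum_sub_distrib, Finset.sum_const, Finset.card_univ, nsmul_eq_mul]
    linear_combination (-f p q) * hc

theorem equivariant_cocycle_condition {f : Q × Q → Q × Q → A} (hE : R.Equivariant f)
    (hf : ∀ p q, R.dTwo f p q = 0)
    (u v w x y z : Q) :
    f (v, w) (y, z) * (delta (R.act (R.act u v) w) (R.act (R.act x y) z)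
      - delta u x) =
    f (u, w) (x, z) * delta (R.act v w) (R.act y z)
      - f (R.act u v, w) (R.act x y, z) * delta v y := by
  have h := hf (u, v, w) (x, y, z)
  have h₃ : (f (u, v) (x, y) - f (R.act u w, R.act v w) (R.act x z, R.act y z)) *
      delta w z = 0 := by
    by_cases hwz : w = z
    · subst hwz
      have := hE _ (R.rho_mem_inn w) (u, v) (x, y)
      change f (R.act u w, R.act v w) (R.act x w, R.act y w) = _ at this
      rw [this, sub_self, zero_mul]
    · rw [delta_of_ne hwz, mul_zero]
  simp only [dTwo_apply] at h
  linear_combination h - h₃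

theorem apply_eq_zero_of_not_bEquiv_left {f : Q × Q → Q × Q → A} (hE : R.Equivariant f)
    (hf : ∀ p q, R.dTwo f p q = 0)
    {v w y z : Q} (hwz : R.BEquiv w z)
    (hvy : ¬ R.BEquiv v y) : f (v, w) (y, z) = 0 := by
  obtain ⟨u, hu⟩ := exists_act_ne hvy
  obtain ⟨x, hx⟩ := (R.act_bijective y).surjective (R.act u v)
  have hx : R.act x y = R.act u v := hx
  have hne : v ≠ y := fun h => hvy (congrArg R.rho h)
  have hux : u ≠ x := fun h => hu (by rw [← hx, h])
  have := equivariant_cocycle_condition hE hf u v w x y z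
  simpa [hwz.act_eq, hx, delta_of_ne hne, delta_of_ne hux] using this

theorem apply_map_left {f : Q × Q → Q × Q → A} (hE : R.Equivariant f)
    (hf : ∀ p q, R.dTwo f p q = 0)
    {w z : Q} (hwz : R.BEquiv w z) {α : Equiv.Perm Q} (hα : α ∈ R.Inn)
    (u x : Q) : f (α u, w) (α x, z) = f (u, w) (x, z) := by
  induction hα using Subgroup.closure_induction generalizing u x with
  | mem α h =>
    obtain ⟨v, rfl⟩ := h
    have := equivariant_cocycle_condition hE hf u v w x v z
    simp only [hwz.act_eq, delta_act_right, delta_self, sub_self, mul_zero, mul_one] at this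
    exact (sub_eq_zero.mp this.symm).symm
  | one => rfl
  | mul α β _ _ iα iβ => simp only [Equiv.Perm.mul_apply, iα, iβ]
  | inv α _ iα => rw [← iα, Equiv.Perm.coe_inv, Equiv.apply_symm_apply, Equiv.apply_symm_apply]

theorem apply_eq_of_act_ne {f : Q × Q → Q × Q → A} (hE : R.Equivariant f)
    (hf : ∀ p q, R.dTwo f p q = 0)
    {v w z : Q} (hv : R.act v w ≠ R.act v z) (u x : Q) :
    f (u, w) (x, z) =
      -f (v, w) (v, z) * (delta (R.act u w) (R.act x z) - delta u x) := by
  obtain ⟨u, rfl⟩ := (R.act_bijective v).surjective u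
  obtain ⟨x, rfl⟩ := (R.act_bijective v).surjective x
  have := equivariant_cocycle_condition hE hf u v w x v z
  simp only [delta_of_ne hv, delta_self] at this
  simp only [delta_act_right]
  linear_combination this

theorem apply_self_eq_of_act_ne {f : Q × Q → Q × Q → A} (hE : R.Equivariant f)
    (hf : ∀ p q, R.dTwo f p q = 0)
    {s t w z : Q} (hs : R.act s w ≠ R.act s z)
    (ht : R.act t w ≠ R.act t z) : f (t, w) (t, z) = f (s, w) (s, z) := by
  simpa [delta_of_ne ht] using apply_eq_of_act_ne hE hf hs t t

/-- An equivariant 2-cocycle is cohomologous to an entropic 2-cochain. -/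
theorem exists_entropic_cohomologous {f : Q × Q → Q × Q → A} (hE : R.Equivariant f)
    (hf : ∀ p q, R.dTwo f p q = 0)
    {m : Ideal A} (hfm : ∀ p q, f p q ∈ m) :
    ∃ e : Q × Q → Q × Q → A, R.EntropicMat2 e ∧ (∀ p q, e p q ∈ m) ∧
      ∃ g : Q → Q → A, (∀ x u, g x u ∈ m) ∧ R.dOne g = f - e := by
  classical
  let g : Q → Q → A := fun w z =>
    if h : R.BEquiv w z then 0
    else -f ((exists_act_ne h).choose, w) ((exists_act_ne h).choose, z)
  have hg : ∀ α ∈ R.Inn, ∀ w z, g (α w) (α z) = g w z := by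
    intro α hα w z
    by_cases h : R.BEquiv w z
    · have h' := (bEquiv_map hα).mpr h
      simp only [g, h, h', dif_pos]
    · have h' := fun h' => h ((bEquiv_map hα).mp h')
      dsimp only [g]
      rw [dif_neg h, dif_neg h']
      have hv := (exists_act_ne h).choose_spec
      have hαv : R.act (α (exists_act_ne h).choose) (α w) ≠
          R.act (α (exists_act_ne h).choose) (α z) := by
        simpa only [← map_act hα, ne_eq, EmbeddingLike.apply_eq_iff_eq] using hv
      rw [apply_self_eq_of_act_ne hE hf hαv (exists_act_ne h').choose_spec]
      exact congrArg Neg.neg (hE α hα (_, w) (_, z))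
  refine ⟨fun p q => if R.BEquiv p.2 q.2 then f p q else 0, ⟨fun u v x y h => ?_,
    fun u v x y α β => ?_⟩, fun p q => ?_, g, fun w z => ?_, ?_⟩
  · by_cases hvy : R.BEquiv v y
    · refine (if_pos hvy).trans ?_
      exact apply_eq_zero_of_not_bEquiv_left hE hf hvy (h.resolve_right (not_not.mpr hvy))
    · exact if_neg hvy
  · simp only [bEquiv_map β.2]
    split_ifs with hvy
    · have h₁ := hE β β.2 (u, v) (x, y)
      have h₂ := apply_map_left hE hf ((bEquiv_map β.2).mpr hvy) α.2
      have h₃ := apply_map_left hE hf ((bEquiv_map β.2).mpr hvy) β.2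
      rw [h₂, ← h₃]
      exact h₁
    · rfl
  · dsimp only
    split_ifs
    exacts [hfm _ _, m.zero_mem]
  · dsimp only [g]
    split_ifs
    exacts [m.zero_mem, m.neg_mem (hfm _ _)]
  · funext ⟨u, w⟩ ⟨x, z⟩
    rw [dOne_apply_of_equivariant hg]
    by_cases h : R.BEquiv w z
    · simp [g, h]
    · simp only [g, h, dif_neg, not_false_eq_true, Pi.sub_apply, if_false, sub_zero]
      exact (apply_eq_of_act_ne hE hf (exists_act_ne h).choose_spec u x).symm

end YBRack

/-- (Theorem on the second Yang–Baxter cohomology.) If `|Inn(Q)|`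
is invertible in `A`, then every 2-cocycle with entries in `m` is cohomologous to
exactly one entropic 2-cochain; moreover every entropic 2-cochain is a cocycle. -/
theorem second_cohomology_entropic
    {A Q : Type*} [CommRing A] (R : YBRack Q) (m : Ideal A)
    [Fintype R.Inn] (hunit : IsUnit ((Fintype.card R.Inn : A)))
    (f : Q × Q → Q × Q → A) (hfm : ∀ p q, f p q ∈ m)
    (hcoc : ∀ p q, R.dTwo f p q = 0) :
    (∃! e : Q × Q → Q × Q → A,
      R.EntropicMat2 e ∧ (∀ p q, e p q ∈ m) ∧
        ∃ g : Q → Q → A, (∀ x u, g x u ∈ m) ∧ ∀ p q, f p q - e p q = R.dOne g p q) ∧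
    (∀ e : Q × Q → Q × Q → A, R.EntropicMat2 e → ∀ p q, R.dTwo e p q = 0) := by
  refine ⟨?_, fun e he => YBRack.dTwo_eq_zero_of_entropic he⟩
  obtain ⟨F, hE, hFm, hF, g₁, hg₁m, hg₁⟩ :=
    YBRack.exists_equivariant_cohomologous hunit hfm hcoc
  obtain ⟨e, he, hem, g₂, hg₂m, hg₂⟩ := YBRack.exists_entropic_cohomologous hE hF hFm
  have hfe : f - e = R.dOne (g₂ - g₁) := by
    refine Eq.symm (((YBRack.dOneLinear A R).map_sub g₂ g₁).trans ?_)
    change R.dOne g₂ - R.dOne g₁ = _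
    rw [hg₁, hg₂]
    abel
  refine ⟨e, ⟨he, hem, g₂ - g₁, fun x u => m.sub_mem (hg₂m _ _) (hg₁m _ _),
    fun p q => congrFun (congrFun hfe p) q⟩, ?_⟩
  rintro e' ⟨he', -, g', -, hg'⟩
  have hfe' : f - e' = R.dOne g' := funext fun p => funext fun q => hg' p q
  refine sub_eq_zero.mp (YBRack.eq_zero_of_entropic_of_eq_dOne hunit (he'.sub he)
    (g := g₂ - g₁ - g') (Eq.symm (((YBRack.dOneLinear A R).map_sub _ _).trans ?_)))
  change R.dOne (g₂ - g₁) - R.dOne g' = _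
  rw [← hfe, ← hfe']
  abel

end
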